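/- arXiv:2009.08399 — 3 statements merged into one kernel-verified Lean document; each statement's English description precedes it below -/
import Mathlib

section
/- Let X_1, …, X_d be nonempty finite sets, let X = X_1 × ⋯ × X_d, and let 𝔄 = (C_S, C_S^acc, F_S, A_S)_{S ⊆ [d]} be an additive system on X such that |A_S| ≤ a for all S ⊆ [d]. Let δ = |C_∅^acc| / |X| be the density of C_∅^acc in X. Then |C_{[d]}^acc| / (|X_1|^2 ⋯ |X_d|^2) ≥ δ^{2^d} · a^{−3^d}. -/
/-! Additive systems (Smith / Koymans–Pagano).

We encode an element of `Y_S = ∏_{i ∈ S} X_i² × ∏_{i ∉ S} X_i` as an element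
`x : ∀ i, X i × X i` which is *diagonal* (both coordinates equal) at every index `i ∉ S`. -/

/-- An additive system on `X = X₁ × ⋯ × X_d`. -/
structure AdditiveSystem (d : ℕ) (X : Fin d → Type*) (A : Finset (Fin d) → Type*)
    [∀ S, AddCommGroup (A S)] [∀ S, Module (ZMod 2) (A S)] where
  /-- the sets `C_S`, encoded diagonally -/
  C : Finset (Fin d) → Set (∀ i, X i × X i)
  /-- the maps `F_S : C_S → A_S` -/
  F : (S : Finset (Fin d)) → C S → A S
  /-- `C_S ⊆ Y_S`: points of `C_S` are diagonal outside `S` -/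
  diag : ∀ S : Finset (Fin d), ∀ x ∈ C S, ∀ i ∉ S, (x i).1 = (x i).2
  /-- recursive description of `C_S` for `S ≠ ∅` -/
  mem_iff : ∀ S : Finset (Fin d), S ≠ ∅ → ∀ x : ∀ i, X i × X i,
    (x ∈ C S ↔ ((∀ i ∉ S, (x i).1 = (x i).2) ∧
      ∀ j ∈ S, ∀ y : ∀ i, X i × X i, (∀ k, k ≠ j → y k = x k) →
        (y j).1 = (y j).2 → ((y j).1 = (x j).1 ∨ (y j).1 = (x j).2) →
        ∃ h : y ∈ C (S.erase j), F (S.erase j) ⟨y, h⟩ = 0))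
  /-- additivity: if `π_j(x₁) = (a,b)`, `π_j(x₂) = (b,c)`, `π_j(x₃) = (a,c)` and the `xᵢ`
  agree away from `j`, then `F_S(x₁) + F_S(x₂) = F_S(x₃)` -/
  additive : ∀ S : Finset (Fin d), ∀ j ∈ S,
    ∀ (x₁ x₂ x₃ : ∀ i, X i × X i) (h₁ : x₁ ∈ C S) (h₂ : x₂ ∈ C S) (h₃ : x₃ ∈ C S),
    (∀ k, k ≠ j → x₁ k = x₂ k ∧ x₁ k = x₃ k) →
    (x₁ j).1 = (x₃ j).1 → (x₁ j).2 = (x₂ j).1 → (x₂ j).2 = (x₃ j).2 →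
    F S ⟨x₁, h₁⟩ + F S ⟨x₂, h₂⟩ = F S ⟨x₃, h₃⟩

namespace AdditiveSystem

variable {d : ℕ} {X : Fin d → Type*} {A : Finset (Fin d) → Type*}
  [∀ S, AddCommGroup (A S)] [∀ S, Module (ZMod 2) (A S)]

/-- The accepted set `C_S^acc = {x ∈ C_S : F_S(x) = 0}`. -/
def Cacc (𝔄 : AdditiveSystem d X A) (S : Finset (Fin d)) : Set (∀ i, X i × X i) :=
  {x | ∃ h : x ∈ 𝔄.C S, 𝔄.F S ⟨x, h⟩ = 0}

end AdditiveSystem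

/-- Cauchy-Schwarz for collisions: if every collision of `h : s → t` produces its own element
of `u`, then `|s|² ≤ |t| |u|`. -/
theorem Finset.card_sq_le_of_collisions {α β γ : Type*} (s : Finset α) (t : Finset β)
    (u : Finset γ) (h : α → β) (hst : ∀ p ∈ s, h p ∈ t) (m : α → α → γ)
    (hm : ∀ p ∈ s, ∀ q ∈ s, h p = h q → m p q ∈ u)
    (hinj : ∀ p ∈ s, ∀ q ∈ s, ∀ p' ∈ s, ∀ q' ∈ s, h p = h q → h p' = h q' →
      m p q = m p' q' → p = p' ∧ q = q') :
    s.card ^ 2 ≤ t.card * u.card := by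
  classical
  have h1 : s.card = ∑ z ∈ t, (s.filter fun p => h p = z).card :=
    Finset.card_eq_sum_card_fiberwise hst
  have h2 : ∑ z ∈ t, (s.filter fun p => h p = z).card ^ 2 ≤ u.card := by
    have h3 : ∑ z ∈ t, (s.filter fun p => h p = z).card ^ 2 =
        ((s ×ˢ s).filter fun w => h w.1 = h w.2).card := by
      rw [Finset.card_eq_sum_card_fiberwise (f := fun w : α × α => h w.1) (t := t)]
      · refine Finset.sum_congr rfl fun z _ => ?_
        rw [sq, ← Finset.card_product]
        congr 1
        ext ⟨p, q⟩
        simp only [Finset.mem_product, Finset.mem_filter]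
        grind
      · intro w hw
        simp only [Finset.coe_filter, Finset.mem_product, Set.mem_ofPred_eq] at hw
        exact hst _ hw.1.1
    rw [h3]
    refine Finset.card_le_card_of_injOn (fun w => m w.1 w.2) ?_ ?_
    · rintro ⟨p, q⟩ hw
      simp only [Finset.coe_filter, Finset.mem_product, Set.mem_ofPred_eq] at hw
      exact hm _ hw.1.1 _ hw.1.2 hw.2
    · rintro ⟨p, q⟩ hw ⟨p', q'⟩ hw' he
      simp only [Finset.coe_filter, Finset.mem_product, Set.mem_ofPred_eq] at hw hw'
      obtain ⟨e1, e2⟩ := hinj _ hw.1.1 _ hw.1.2 _ hw'.1.1 _ hw'.1.2 hw.2 hw'.2 he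
      rw [e1, e2]
  calc s.card ^ 2 = (∑ z ∈ t, (s.filter fun p => h p = z).card) ^ 2 := by rw [← h1]
    _ ≤ t.card * ∑ z ∈ t, (s.filter fun p => h p = z).card ^ 2 := sq_sum_le_card_mul_sum_sq
    _ ≤ t.card * u.card := Nat.mul_le_mul_left _ h2

namespace AdditiveSystem

section

open Function

variable {d : ℕ} {X : Fin d → Type*} {A : Finset (Fin d) → Type*}
  [∀ S, AddCommGroup (A S)] [∀ S, Module (ZMod 2) (A S)]

theorem Cacc_subset_C (𝔄 : AdditiveSystem d X A) (S : Finset (Fin d)) : 𝔄.Cacc S ⊆ 𝔄.C S :=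
  fun _ hx => hx.1

/-- A point lies in `C_S` iff it is diagonal outside `S` and all its facets are accepted. -/
theorem mem_C_iff (𝔄 : AdditiveSystem d X A) {S : Finset (Fin d)} (hS : S.Nonempty)
    (x : ∀ i, X i × X i) :
    x ∈ 𝔄.C S ↔ (∀ i ∉ S, (x i).1 = (x i).2) ∧ ∀ i ∈ S, ∀ c, (c = (x i).1 ∨ c = (x i).2) →
      update x i (c, c) ∈ 𝔄.Cacc (S.erase i) := by
  rw [𝔄.mem_iff S hS.ne_empty]
  refine and_congr_right fun _ => forall₂_congr fun i _ => ⟨fun h c hc => ?_, fun h y h1 h2 h3 => ?_⟩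
  · refine h _ (fun k hk => by simp [hk]) (by simp) (by simpa using hc)
  · have : y = update x i ((y i).1, (y i).1) := by
      funext k
      by_cases hk : k = i
      · subst hk
        ext <;> simp [h2]
      · simp [hk, h1 k hk]
    rw [this]
    exact h _ h3

theorem update_mem_C_iff (𝔄 : AdditiveSystem d X A) {S : Finset (Fin d)} {j : Fin d} (hj : j ∈ S)
    (y : ∀ i, X i × X i) (a b : X j) :
    update y j (a, b) ∈ 𝔄.C S ↔ (∀ i ∉ S, (y i).1 = (y i).2) ∧
      (∀ c, (c = a ∨ c = b) → update y j (c, c) ∈ 𝔄.Cacc (S.erase j)) ∧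
      ∀ i ∈ S, i ≠ j → ∀ c, (c = (y i).1 ∨ c = (y i).2) →
        update (update y i (c, c)) j (a, b) ∈ 𝔄.Cacc (S.erase i) := by
  rw [𝔄.mem_C_iff ⟨j, hj⟩]
  refine and_congr (forall₂_congr fun i hi => ?_) ⟨fun h => ⟨?_, ?_⟩, fun h i hi c hc => ?_⟩
  · rw [update_of_ne (by rintro rfl; exact hi hj)]
  · simpa using h j hj
  · intro i hi hij c hc
    rw [update_comm hij]
    exact h i hi c (by simpa [hij] using hc)
  · by_cases hij : i = j
    · subst hij
      simpa using h.1 c (by simpa using hc)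
    · rw [← update_comm hij]
      exact h.2 i hi hij c (by simpa [hij] using hc)

theorem C_symm_of (𝔄 : AdditiveSystem d X A) {S : Finset (Fin d)} {j : Fin d} (hj : j ∈ S)
    (ih : ∀ i ∈ S, i ≠ j → ∀ (y : ∀ i, X i × X i) (a b : X j),
      update y j (a, b) ∈ 𝔄.Cacc (S.erase i) → update y j (b, a) ∈ 𝔄.Cacc (S.erase i))
    (y : ∀ i, X i × X i) (a b : X j) (h : update y j (a, b) ∈ 𝔄.C S) :
    update y j (b, a) ∈ 𝔄.C S := by
  rw [𝔄.update_mem_C_iff hj] at h ⊢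
  exact ⟨h.1, fun c hc => h.2.1 c hc.symm, fun i hi hij c hc => ih i hi hij _ _ _ (h.2.2 i hi hij c hc)⟩

theorem C_trans_of (𝔄 : AdditiveSystem d X A) {S : Finset (Fin d)} {j : Fin d} (hj : j ∈ S)
    (ih : ∀ i ∈ S, i ≠ j → ∀ (y : ∀ i, X i × X i) (a b c : X j),
      update y j (a, b) ∈ 𝔄.Cacc (S.erase i) → update y j (b, c) ∈ 𝔄.Cacc (S.erase i) →
      update y j (a, c) ∈ 𝔄.Cacc (S.erase i))
    (y : ∀ i, X i × X i) (a b c : X j) (h : update y j (a, b) ∈ 𝔄.C S)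
    (h' : update y j (b, c) ∈ 𝔄.C S) :
    update y j (a, c) ∈ 𝔄.C S := by
  rw [𝔄.update_mem_C_iff hj] at h h' ⊢
  refine ⟨h.1, ?_, fun i hi hij e he => ih i hi hij _ _ _ _ (h.2.2 i hi hij e he)
    (h'.2.2 i hi hij e he)⟩
  rintro e (rfl | rfl)
  · exact h.2.1 _ (.inl rfl)
  · exact h'.2.1 _ (.inr rfl)

theorem F_add (𝔄 : AdditiveSystem d X A) {S : Finset (Fin d)} {j : Fin d} (hj : j ∈ S)
    (y : ∀ i, X i × X i) {a b c : X j} (h₁ : update y j (a, b) ∈ 𝔄.C S)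
    (h₂ : update y j (b, c) ∈ 𝔄.C S) (h₃ : update y j (a, c) ∈ 𝔄.C S) :
    𝔄.F S ⟨_, h₁⟩ + 𝔄.F S ⟨_, h₂⟩ = 𝔄.F S ⟨_, h₃⟩ :=
  𝔄.additive S j hj _ _ _ h₁ h₂ h₃ (fun k hk => by simp [hk]) (by simp) (by simp) (by simp)

/-- For fixed other coordinates, acceptance is a partial equivalence relation in the `j`-th
pair. -/
theorem Cacc_symm_trans (𝔄 : AdditiveSystem d X A) (S : Finset (Fin d)) {j : Fin d} (hj : j ∈ S) :
    (∀ (y : ∀ i, X i × X i) (a b : X j),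
      update y j (a, b) ∈ 𝔄.Cacc S → update y j (b, a) ∈ 𝔄.Cacc S) ∧
    (∀ (y : ∀ i, X i × X i) (a b c : X j),
      update y j (a, b) ∈ 𝔄.Cacc S → update y j (b, c) ∈ 𝔄.Cacc S →
      update y j (a, c) ∈ 𝔄.Cacc S) := by
  induction S using Finset.strongInduction with
  | H S ih =>
    have ih' := fun i (hi : i ∈ S) (hij : i ≠ j) =>
      ih _ (Finset.erase_ssubset hi) (Finset.mem_erase.2 ⟨hij.symm, hj⟩)
    have hs := 𝔄.C_symm_of hj fun i hi hij => (ih' i hi hij).1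
    have ht := 𝔄.C_trans_of hj fun i hi hij => (ih' i hi hij).2
    constructor
    · rintro y a b ⟨h, h0⟩
      have hba := hs _ _ _ h
      have haa := ht _ _ _ _ h hba
      have e1 := 𝔄.F_add hj y haa haa haa
      have e2 := 𝔄.F_add hj y h hba haa
      rw [add_eq_left] at e1
      rw [h0, e1, zero_add] at e2
      exact ⟨hba, e2⟩
    · rintro y a b c ⟨h, h0⟩ ⟨h', h0'⟩
      have e := 𝔄.F_add hj y h h' (ht _ _ _ _ h h')
      rw [h0, h0', zero_add] at e
      exact ⟨_, e.symm⟩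

theorem C_symm (𝔄 : AdditiveSystem d X A) {S : Finset (Fin d)} {j : Fin d} (hj : j ∈ S)
    (y : ∀ i, X i × X i) {a b : X j} (h : update y j (a, b) ∈ 𝔄.C S) :
    update y j (b, a) ∈ 𝔄.C S :=
  𝔄.C_symm_of hj (fun i _ hij => (𝔄.Cacc_symm_trans (S.erase i)
    (Finset.mem_erase.2 ⟨hij.symm, hj⟩)).1) y a b h

theorem C_trans (𝔄 : AdditiveSystem d X A) {S : Finset (Fin d)} {j : Fin d} (hj : j ∈ S)
    (y : ∀ i, X i × X i) {a b c : X j} (h₁ : update y j (a, b) ∈ 𝔄.C S)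
    (h₂ : update y j (b, c) ∈ 𝔄.C S) : update y j (a, c) ∈ 𝔄.C S :=
  𝔄.C_trans_of hj (fun i _ hij => (𝔄.Cacc_symm_trans (S.erase i)
    (Finset.mem_erase.2 ⟨hij.symm, hj⟩)).2) y a b c h₁ h₂

/-- In the `j`-th pair, `F_S` is a coboundary. -/
theorem exists_potential (𝔄 : AdditiveSystem d X A) (S : Finset (Fin d)) (j : Fin d) (hj : j ∈ S)
    (y : ∀ i, X i × X i) : ∃ φ : X j → A S, ∀ a b, update y j (a, b) ∈ 𝔄.C S → φ a = φ b →
      update y j (a, b) ∈ 𝔄.Cacc S := by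
  classical
  have hrep : ∃ r : Set (X j) → X j, ∀ s : Set (X j), s.Nonempty → r s ∈ s := by
    by_cases hne : Nonempty (X j)
    · exact ⟨fun s => if h : s.Nonempty then h.some else hne.some, fun s h => by
        simpa [h] using h.some_mem⟩
    · exact ⟨fun _ => (y j).1, fun s h => absurd ⟨h.some⟩ hne⟩
  obtain ⟨r, hr⟩ := hrep
  let cls : X j → Set (X j) := fun a => {b | update y j (b, a) ∈ 𝔄.C S}
  refine ⟨fun a => if h : update y j (r (cls a), a) ∈ 𝔄.C S then 𝔄.F S ⟨_, h⟩ else 0,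
    fun a b hab hφ => ?_⟩
  have hba := 𝔄.C_symm hj y hab
  have hcls : cls a = cls b := by
    ext c
    exact ⟨fun h => 𝔄.C_trans hj y h hab, fun h => 𝔄.C_trans hj y h hba⟩
  have ha : update y j (r (cls a), a) ∈ 𝔄.C S := hr (cls a) ⟨b, hba⟩
  have hb : update y j (r (cls a), b) ∈ 𝔄.C S := 𝔄.C_trans hj y ha hab
  have e := 𝔄.F_add hj y ha hab hb
  simp only [← hcls, ha, hb, dif_pos] at hφ
  rw [hφ, add_eq_left] at e
  exact ⟨hab, e⟩

/-- The face of the cube `x` that keeps the pairs where `f` is `none` and selects a vertex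
elsewhere. -/
def face (x : ∀ i, X i × X i) (f : Fin d → Option Bool) : ∀ i, X i × X i := fun i =>
  match f i with
  | none => x i
  | some false => ((x i).1, (x i).1)
  | some true => ((x i).2, (x i).2)

/-- Index set of the faces of a cube with directions `T`. -/
def faces (T : Finset (Fin d)) : Finset (Fin d → Option Bool) :=
  Fintype.piFinset fun i => if i ∈ T then Finset.univ else {none}

theorem card_faces (T : Finset (Fin d)) : (faces T).card = 3 ^ T.card := by
  rw [faces, Fintype.card_piFinset, ← Finset.prod_const, ← Finset.prod_subset T.subset_univ]
  · exact Finset.prod_congr rfl fun i hi => by simp [hi]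
  · intro i _ hi
    simp [hi]

/-- Directions of the face `f`. -/
def dirs (T : Finset (Fin d)) (f : Fin d → Option Bool) : Finset (Fin d) :=
  T.filter fun i => f i = none

theorem exists_update_face (x : ∀ i, X i × X i) (T : Finset (Fin d)) (f : Fin d → Option Bool)
    (hf : f ∈ faces T) (i : Fin d) (hi : i ∈ dirs T f) (c : X i)
    (hc : c = (face x f i).1 ∨ c = (face x f i).2) :
    ∃ f' ∈ faces T, dirs T f' = (dirs T f).erase i ∧ face x f' = update (face x f) i (c, c) := by
  have hi' : i ∈ T ∧ f i = none := by simpa [dirs] using hi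
  have key : ∀ b, update f i (some b) ∈ faces T ∧
      dirs T (update f i (some b)) = (dirs T f).erase i := by
    intro b
    constructor
    · simp only [faces, Fintype.mem_piFinset] at hf ⊢
      intro k
      by_cases hk : k = i
      · subst hk
        simp [hi'.1]
      · simpa [hk] using hf k
    · ext k
      by_cases hk : k = i
      · subst hk
        simp [dirs]
      · simp [dirs, hk]
  have hx : face x f i = x i := by simp [face, hi'.2]
  rw [hx] at hc
  rcases hc with rfl | rfl
  · refine ⟨_, (key false).1, (key false).2, ?_⟩
    funext k
    by_cases hk : k = i
    · subst hk
      simp [face]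
    · simp [face, hk]
  · refine ⟨_, (key true).1, (key true).2, ?_⟩
    funext k
    by_cases hk : k = i
    · subst hk
      simp [face]
    · simp [face, hk]

/-- If `a`, `b` have equal potentials on every face of `x`, they form an accepted pair over
`x`. -/
theorem update_mem_Cacc_insert (𝔄 : AdditiveSystem d X A) {T : Finset (Fin d)} {j : Fin d}
    (hj : j ∉ T) (x : ∀ i, X i × X i) (a b : X j)
    (hφ : ∀ f ∈ faces T, update (face x f) j (a, b) ∈ 𝔄.C (insert j (dirs T f)) →
      update (face x f) j (a, b) ∈ 𝔄.Cacc (insert j (dirs T f)))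
    (S : Finset (Fin d)) : ∀ f ∈ faces T, dirs T f = S →
      update (face x f) j (a, a) ∈ 𝔄.Cacc S → update (face x f) j (b, b) ∈ 𝔄.Cacc S →
      update (face x f) j (a, b) ∈ 𝔄.Cacc (insert j S) := by
  induction S using Finset.strongInduction with
  | H S ih =>
    rintro f hf rfl ha hb
    have hjS : j ∉ dirs T f := fun h => hj (Finset.mem_filter.1 h).1
    refine hφ f hf ?_
    rw [𝔄.update_mem_C_iff (Finset.mem_insert_self _ _), Finset.erase_insert hjS]
    refine ⟨fun i hi => ?_, ?_, fun i hi hij c hc => ?_⟩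
    · rw [Finset.mem_insert, not_or] at hi
      simpa [hi.1] using 𝔄.diag _ _ ha.1 i hi.2
    · rintro c (rfl | rfl)
      exacts [ha, hb]
    · have hi : i ∈ dirs T f := Finset.mem_of_mem_insert_of_ne hi hij
      obtain ⟨f', hf', hd, he⟩ := exists_update_face x T f hf i hi c hc
      rw [Finset.erase_insert_of_ne hij.symm, ← he]
      have hfacet : ∀ e : X j, update (face x f) j (e, e) ∈ 𝔄.Cacc (dirs T f) →
          update (face x f') j (e, e) ∈ 𝔄.Cacc ((dirs T f).erase i) := by
        intro e h
        rw [he, update_comm hij]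
        exact ((𝔄.mem_C_iff ⟨i, hi⟩ _).1 h.1).2 i hi c (by simpa [hij] using hc)
      exact ih _ (Finset.erase_ssubset hi) f' hf' hd (hfacet a ha) (hfacet b hb)

variable [∀ i, Fintype (X i)]

/-- The cardinality of the product `Y_T`. -/
def cubes (X : Fin d → Type*) [∀ i, Fintype (X i)] (T : Finset (Fin d)) : ℕ :=
  ∏ i, if i ∈ T then Fintype.card (X i) ^ 2 else Fintype.card (X i)

theorem card_Cacc_sq_le [∀ i, Nonempty (X i)] [∀ S, Fintype (A S)]
    (𝔄 : AdditiveSystem d X A) (a : ℕ) (ha : ∀ S, Fintype.card (A S) ≤ a)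
    (T : Finset (Fin d)) (j : Fin d) (hj : j ∉ T) :
    Nat.card (𝔄.Cacc T) ^ 2 * Fintype.card (X j) ≤
      cubes X T * a ^ 3 ^ T.card * Nat.card (𝔄.Cacc (insert j T)) := by
  classical
  let c : X j := Classical.arbitrary _
  choose φ hφ using 𝔄.exists_potential
  let diagEmb : ∀ i, X i ↪ X i × X i := fun i => ⟨fun e => (e, e), fun _ _ h => (Prod.ext_iff.1 h).1⟩
  let P : Finset (∀ i, X i × X i) := Fintype.piFinset fun i =>
    if i = j then {(update (fun i => Classical.arbitrary (X i × X i)) j (c, c)) i}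
    else if i ∈ T then Finset.univ else Finset.univ.map (diagEmb i)
  have hP : P.card * Fintype.card (X j) = cubes X T := by
    rw [Fintype.card_piFinset, cubes, ← Finset.mul_prod_erase _ _ (Finset.mem_univ j),
      ← Finset.mul_prod_erase (a := j) (s := Finset.univ) _ (Finset.mem_univ j)]
    simp only [if_true, Finset.card_singleton, one_mul, if_neg hj]
    rw [mul_comm]
    congr 1
    refine Finset.prod_congr rfl fun i hi => ?_
    rw [if_neg (Finset.mem_erase.1 hi).1]
    split_ifs <;> simp [sq]
  let G := ∀ f : faces T, A (insert j (dirs T f))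
  have hG : Fintype.card G ≤ a ^ 3 ^ T.card := by
    rw [Fintype.card_pi, ← card_faces T, ← Fintype.card_coe (faces T)]
    exact Finset.prod_le_pow_card _ _ _ fun f _ => ha _
  let g : (∀ i, X i × X i) → X j → G := fun x e f =>
    φ (insert j (dirs T f)) j (Finset.mem_insert_self _ _) (face x f) e
  have hfin : ∀ S, (𝔄.Cacc S).Finite := fun S => Set.toFinite _
  have hcard : ∀ S, Nat.card (𝔄.Cacc S) = (hfin S).toFinset.card := fun S =>
    Set.ncard_eq_toFinset_card _ (hfin S)
  have hd : ∀ p ∈ 𝔄.Cacc T, p = update p j ((p j).1, (p j).1) := by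
    intro p hp
    have := 𝔄.diag T p hp.1 j hj
    rw [eq_comm, update_eq_self_iff]
    exact Prod.ext rfl this
  have main := Finset.card_sq_le_of_collisions (hfin T).toFinset (P ×ˢ (Finset.univ : Finset G))
    (hfin (insert j T)).toFinset
    (fun p => (update p j (c, c), g (update p j (c, c)) (p j).1)) ?_
    (fun p q => update p j ((p j).1, (q j).1)) ?_ ?_
  · rw [← hcard, ← hcard, Finset.card_product, Finset.card_univ] at main
    calc _ ≤ P.card * Fintype.card G * Nat.card (𝔄.Cacc (insert j T)) * Fintype.card (X j) :=
          Nat.mul_le_mul_right _ main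
      _ = P.card * Fintype.card (X j) * Fintype.card G * Nat.card (𝔄.Cacc (insert j T)) := by ring
      _ ≤ _ := by
        rw [hP]
        gcongr
  · intro p hp
    rw [Set.Finite.mem_toFinset] at hp
    simp only [Finset.mem_product, Finset.mem_univ, and_true, P, Fintype.mem_piFinset]
    intro i
    by_cases hi : i = j
    · subst hi
      simp
    · by_cases hT : i ∈ T
      · simp [hi, hT]
      · have := 𝔄.diag T p hp.1 i hT
        simp only [hi, hT, if_false, ne_eq, not_false_eq_true, update_of_ne, Finset.mem_map,
          Finset.mem_univ, true_and]
        exact ⟨(p i).1, Prod.ext rfl this⟩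
  · intro p hp q hq hpq
    rw [Set.Finite.mem_toFinset] at hp hq ⊢
    rw [Prod.mk.injEq] at hpq
    obtain ⟨hbase, hval⟩ := hpq
    rw [← hbase] at hval
    have hf0 : (fun _ => none) ∈ faces T := by
      simp only [faces, Fintype.mem_piFinset]
      intro i
      split_ifs <;> simp
    have hface : face (update p j (c, c)) (fun _ => none) = update p j (c, c) := rfl
    have h := 𝔄.update_mem_Cacc_insert hj (update p j (c, c)) (p j).1 (q j).1
      (fun f hf h => hφ _ j _ _ _ _ h (congrFun hval ⟨f, hf⟩)) T _ hf0 (by simp [dirs])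
    simp only [hface, update_idem] at h
    refine h (by rwa [← hd p hp]) ?_
    rw [← update_idem (a := j) (v := (c, c)) (f := p), hbase, update_idem, ← hd q hq]
    exact hq
  · intro p hp q hq p' hp' q' hq' hpq hpq' he
    rw [Set.Finite.mem_toFinset] at hp hq hp' hq'
    have hpq := (Prod.mk.injEq _ _ _ _ ▸ hpq).1
    have hpq' := (Prod.mk.injEq _ _ _ _ ▸ hpq').1
    have hj' := congrFun he j
    simp only [update_self, Prod.mk.injEq] at hj'
    have hb : ∀ v, update p j v = update p' j v := fun v => by
      have := congrArg (fun z => update z j v) he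
      simpa using this
    have hb' : ∀ v, update q j v = update q' j v := fun v => by
      have := congrArg (fun z => update z j v) (hpq.symm.trans ((hb (c, c)).trans hpq'))
      simpa using this
    constructor
    · rw [hd p hp, hd p' hp', hb, hj'.1]
    · rw [hd q hq, hd q' hq', hb', hj'.2]

theorem cubes_insert {T : Finset (Fin d)} {j : Fin d} (hj : j ∉ T) :
    cubes X (insert j T) = cubes X T * Fintype.card (X j) := by
  rw [cubes, cubes, ← Finset.mul_prod_erase _ _ (Finset.mem_univ j),
    ← Finset.mul_prod_erase (a := j) (s := Finset.univ) _ (Finset.mem_univ j)]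
  rw [if_pos (Finset.mem_insert_self _ _), if_neg hj]
  have : ∀ i ∈ Finset.univ.erase j,
      (if i ∈ insert j T then Fintype.card (X i) ^ 2 else Fintype.card (X i)) =
      if i ∈ T then Fintype.card (X i) ^ 2 else Fintype.card (X i) := fun i hi => by
    simp [(Finset.mem_erase.1 hi).1]
  rw [Finset.prod_congr rfl this]
  ring

theorem cubes_pos [∀ i, Nonempty (X i)] (T : Finset (Fin d)) : 0 < cubes X T :=
  Finset.prod_pos fun i _ => by
    have : 0 < Fintype.card (X i) := Fintype.card_pos
    split_ifs <;> positivity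

theorem density_Cacc [∀ i, Nonempty (X i)] [∀ S, Fintype (A S)]
    (𝔄 : AdditiveSystem d X A) (a : ℕ) (ha : ∀ S, Fintype.card (A S) ≤ a)
    (T : Finset (Fin d)) :
    ((Nat.card (𝔄.Cacc ∅) : ℝ) / cubes X ∅ * a) ^ 2 ^ T.card ≤
      (Nat.card (𝔄.Cacc T) : ℝ) / cubes X T * a ^ 3 ^ T.card := by
  induction T using Finset.induction_on with
  | empty => simp
  | insert j T hj ih =>
    have hc : (0 : ℝ) < cubes X T := by exact_mod_cast cubes_pos T
    have hx : (0 : ℝ) < Fintype.card (X j) := by exact_mod_cast Fintype.card_pos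
    have step : ((Nat.card (𝔄.Cacc T) : ℝ) / cubes X T) ^ 2 ≤
        a ^ 3 ^ T.card * ((Nat.card (𝔄.Cacc (insert j T)) : ℝ) / cubes X (insert j T)) := by
      have h : (Nat.card (𝔄.Cacc T) : ℝ) ^ 2 * Fintype.card (X j) ≤
          cubes X T * a ^ 3 ^ T.card * Nat.card (𝔄.Cacc (insert j T)) := by
        exact_mod_cast 𝔄.card_Cacc_sq_le a ha T j hj
      rw [cubes_insert hj, Nat.cast_mul, div_pow, ← mul_div_assoc,
        div_le_div_iff₀ (by positivity) (by positivity)]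
      nlinarith [mul_le_mul_of_nonneg_right h hc.le]
    rw [Finset.card_insert_of_notMem hj, pow_succ 2, pow_mul]
    calc _ ≤ ((Nat.card (𝔄.Cacc T) : ℝ) / cubes X T * a ^ 3 ^ T.card) ^ 2 := by gcongr
      _ = ((Nat.card (𝔄.Cacc T) : ℝ) / cubes X T) ^ 2 * (a ^ 3 ^ T.card) ^ 2 := by ring
      _ ≤ a ^ 3 ^ T.card * ((Nat.card (𝔄.Cacc (insert j T)) : ℝ) / cubes X (insert j T)) *
          (a ^ 3 ^ T.card) ^ 2 := by gcongr
      _ = _ := by ring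

end

end AdditiveSystem

/-- Proposition 2.2 (the shrinking lemma): lower bound for the density of the accepted set
`C_{[d]}^acc` in terms of the density `δ` of `C_∅^acc` in `X`. -/
theorem AdditiveSystem.density_Cacc_univ {d : ℕ} {X : Fin d → Type*}
    {A : Finset (Fin d) → Type*} [∀ S, AddCommGroup (A S)] [∀ S, Module (ZMod 2) (A S)]
    [∀ i, Fintype (X i)] [∀ i, Nonempty (X i)] [∀ S, Fintype (A S)]
    (𝔄 : AdditiveSystem d X A) (a : ℕ) (ha : ∀ S, Fintype.card (A S) ≤ a)
    (δ : ℝ) (hδ : δ = (Nat.card (𝔄.Cacc ∅) : ℝ) / ∏ i, (Fintype.card (X i) : ℝ)) :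
    (Nat.card (𝔄.Cacc Finset.univ) : ℝ) / ∏ i, ((Fintype.card (X i) : ℝ)) ^ 2 ≥
      δ ^ (2 ^ d) * (a : ℝ) ^ (-(3 ^ d : ℤ)) := by
  have h := 𝔄.density_Cacc a ha Finset.univ
  have ha1 : (1 : ℝ) ≤ a := by
    exact_mod_cast (Fintype.card_pos (α := A ∅)).trans_le (ha ∅)
  simp only [cubes, Finset.notMem_empty, if_false, Finset.mem_univ, if_true, Finset.card_univ,
    Fintype.card_fin, Nat.cast_prod, Nat.cast_pow] at h
  rw [← hδ, mul_pow] at h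
  have hδ0 : 0 ≤ δ := hδ ▸ by positivity
  have h1 : δ ^ 2 ^ d ≤ δ ^ 2 ^ d * (a : ℝ) ^ 2 ^ d :=
    le_mul_of_one_le_right (by positivity) (one_le_pow₀ ha1)
  have hz : (a : ℝ) ^ (-(3 ^ d : ℤ)) = ((a : ℝ) ^ 3 ^ d)⁻¹ := by
    rw [zpow_neg]
    exact_mod_cast rfl
  rw [ge_iff_le, hz, ← div_eq_mul_inv, div_le_iff₀ (by positivity)]
  exact h1.trans h
end

section
/- Let 𝔄 = (C_S, C_S^acc, F_S, A_S)_{S ⊆ [d]} be an additive system on X = X_1 × ⋯ × X_d with d ≥ 1, and fix x ∈ ∏_{i∈[d−1]} X_i^2. Define V(x) := {a ∈ X_d : (x, a) ∈ C_{[d−1]}^acc} and W(x) := {(a, b) ∈ X_d^2 : (x, (a, b)) ∈ C_{[d]}^acc}. Then W(x) ⊆ V(x) × V(x), and the relation on V(x) given by a ∼ b iff (a, b) ∈ W(x) is an equivalence relation on V(x) (reflexive, symmetric and transitive). -/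
namespace AdditiveSystem

open Function

variable {d : ℕ} {X : Fin d → Type*} {A : Finset (Fin d) → Type*}
  [∀ S, AddCommGroup (A S)] [∀ S, Module (ZMod 2) (A S)]

/-- The recursive description of `C_S`, phrased with `Function.update`. -/
theorem mem_C_iff_update (𝔄 : AdditiveSystem d X A) {S : Finset (Fin d)} (hS : S ≠ ∅)
    (z : ∀ i, X i × X i) :
    z ∈ 𝔄.C S ↔ (∀ i ∉ S, (z i).1 = (z i).2) ∧
      ∀ j ∈ S, ∀ a, (a = (z j).1 ∨ a = (z j).2) → update z j (a, a) ∈ 𝔄.Cacc (S.erase j) := by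
  rw [𝔄.mem_iff S hS]
  refine and_congr_right fun _ => forall₂_congr fun j _ => ⟨fun h a ha => ?_, fun h y hy hd hj => ?_⟩
  · exact h _ (fun k hk => by simp [hk]) (by simp) (by simpa using ha)
  · have : y = update z j ((y j).1, (y j).1) := by
      rw [eq_update_iff]
      exact ⟨Prod.ext rfl hd.symm, fun k hk => hy k hk⟩
    rw [this]
    exact h _ hj

/-- Faces of points of `C_S` are accepted. -/
theorem update_mem_Cacc_erase (𝔄 : AdditiveSystem d X A) {S : Finset (Fin d)}
    {z : ∀ i, X i × X i} (hz : z ∈ 𝔄.C S) {j : Fin d} (hj : j ∈ S) {a : X j}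
    (ha : a = (z j).1 ∨ a = (z j).2) : update z j (a, a) ∈ 𝔄.Cacc (S.erase j) :=
  ((𝔄.mem_C_iff_update (Finset.ne_empty_of_mem hj) z).1 hz).2 j hj a ha

theorem F_add_F_update (𝔄 : AdditiveSystem d X A) {S : Finset (Fin d)} {j : Fin d} (hj : j ∈ S)
    (z : ∀ i, X i × X i) {a b c : X j} (h₁ : update z j (a, b) ∈ 𝔄.C S)
    (h₂ : update z j (b, c) ∈ 𝔄.C S) (h₃ : update z j (a, c) ∈ 𝔄.C S) :
    𝔄.F S ⟨_, h₁⟩ + 𝔄.F S ⟨_, h₂⟩ = 𝔄.F S ⟨_, h₃⟩ :=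
  𝔄.additive S j hj _ _ _ h₁ h₂ h₃ (fun k hk => by simp [hk]) (by simp) (by simp) (by simp)

/-- An accepted point stays accepted when a coordinate is doubled. -/
theorem Cacc_subset_Cacc_insert (𝔄 : AdditiveSystem d X A) (j : Fin d) (S : Finset (Fin d))
    (hj : j ∉ S) : 𝔄.Cacc S ⊆ 𝔄.Cacc (insert j S) := by
  induction S using Finset.strongInduction with
  | H S ih =>
    rintro z ⟨hz, hF⟩
    have hd := 𝔄.diag S z hz
    have hzj : z = update z j ((z j).1, (z j).1) := by
      rw [eq_update_iff]
      exact ⟨Prod.ext rfl (hd j hj).symm, fun _ _ => rfl⟩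
    have hC : z ∈ 𝔄.C (insert j S) := by
      rw [𝔄.mem_C_iff_update (Finset.insert_ne_empty j S)]
      refine ⟨fun i hi => hd i fun h => hi (Finset.mem_insert_of_mem h), fun k hk a ha => ?_⟩
      obtain rfl | hkS := Finset.mem_insert.1 hk
      · have ha' : a = (z k).1 := ha.elim id fun h => h.trans (hd k hj).symm
        rw [Finset.erase_insert hj, ha', ← hzj]
        exact ⟨hz, hF⟩
      · have hkj : j ≠ k := fun h => hj (h ▸ hkS)
        rw [Finset.erase_insert_of_ne hkj]
        exact ih _ (Finset.erase_ssubset hkS) (fun h => hj (Finset.mem_of_mem_erase h))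
          (𝔄.update_mem_Cacc_erase hz hkS ha)
    refine ⟨hC, ?_⟩
    have := 𝔄.additive _ j (Finset.mem_insert_self j S) z z z hC hC hC
      (fun _ _ => ⟨rfl, rfl⟩) rfl (hd j hj).symm rfl
    simpa using this

/-- Diagonal points over an accepted face are accepted. -/
theorem update_diag_mem_Cacc (𝔄 : AdditiveSystem d X A) {S : Finset (Fin d)} {j : Fin d}
    (hj : j ∈ S) {z : ∀ i, X i × X i} {a : X j}
    (h : update z j (a, a) ∈ 𝔄.Cacc (S.erase j)) : update z j (a, a) ∈ 𝔄.Cacc S := by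
  have := 𝔄.Cacc_subset_Cacc_insert j _ (Finset.notMem_erase j S) h
  rwa [Finset.insert_erase hj] at this

/-- The faces of an accepted point in direction `j` are accepted. -/
theorem faces_mem_Cacc (𝔄 : AdditiveSystem d X A) {S : Finset (Fin d)} {j : Fin d}
    (hj : j ∈ S) {z : ∀ i, X i × X i} {a b : X j} (h : update z j (a, b) ∈ 𝔄.C S) :
    update z j (a, a) ∈ 𝔄.Cacc (S.erase j) ∧ update z j (b, b) ∈ 𝔄.Cacc (S.erase j) := by
  constructor
  · simpa using 𝔄.update_mem_Cacc_erase h hj (a := a) (by simp)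
  · simpa using 𝔄.update_mem_Cacc_erase h hj (a := b) (by simp)

theorem update_swap_mem_Cacc (𝔄 : AdditiveSystem d X A) (j : Fin d) (a b : X j)
    (S : Finset (Fin d)) (hj : j ∈ S) (z : ∀ i, X i × X i)
    (h : update z j (a, b) ∈ 𝔄.Cacc S) : update z j (b, a) ∈ 𝔄.Cacc S := by
  induction S using Finset.strongInduction generalizing z with
  | H S ih =>
    obtain ⟨hC, hF⟩ := h
    obtain ⟨ha, hb⟩ := 𝔄.faces_mem_Cacc hj hC
    have hC' : update z j (b, a) ∈ 𝔄.C S := by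
      rw [𝔄.mem_C_iff_update (Finset.ne_empty_of_mem hj)]
      refine ⟨fun i hi => ?_, fun k hk e he => ?_⟩
      · have hij : i ≠ j := fun h => hi (h ▸ hj)
        simpa [hij] using 𝔄.diag S _ hC i hi
      · obtain rfl | hkj := eq_or_ne k j
        · obtain rfl | rfl : e = b ∨ e = a := by simpa using he
          · simpa using hb
          · simpa using ha
        · rw [update_comm hkj.symm]
          refine ih _ (Finset.erase_ssubset hk) (Finset.mem_erase.2 ⟨hkj.symm, hj⟩) _ ?_
          rw [update_comm hkj]
          exact 𝔄.update_mem_Cacc_erase hC hk (by simpa [hkj] using he)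
    obtain ⟨hCa, hFa⟩ := 𝔄.update_diag_mem_Cacc hj ha
    refine ⟨hC', ?_⟩
    simpa [hF, hFa] using 𝔄.F_add_F_update hj z hC hC' hCa

theorem update_trans_mem_Cacc (𝔄 : AdditiveSystem d X A) (j : Fin d) (a b c : X j)
    (S : Finset (Fin d)) (hj : j ∈ S) (z : ∀ i, X i × X i)
    (h₁ : update z j (a, b) ∈ 𝔄.Cacc S) (h₂ : update z j (b, c) ∈ 𝔄.Cacc S) :
    update z j (a, c) ∈ 𝔄.Cacc S := by
  induction S using Finset.strongInduction generalizing z with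
  | H S ih =>
    obtain ⟨hC₁, hF₁⟩ := h₁
    obtain ⟨hC₂, hF₂⟩ := h₂
    have hC : update z j (a, c) ∈ 𝔄.C S := by
      rw [𝔄.mem_C_iff_update (Finset.ne_empty_of_mem hj)]
      refine ⟨fun i hi => ?_, fun k hk e he => ?_⟩
      · have hij : i ≠ j := fun h => hi (h ▸ hj)
        simpa [hij] using 𝔄.diag S _ hC₁ i hi
      · obtain rfl | hkj := eq_or_ne k j
        · obtain rfl | rfl : e = a ∨ e = c := by simpa using he
          · simpa using (𝔄.faces_mem_Cacc hj hC₁).1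
          · simpa using (𝔄.faces_mem_Cacc hj hC₂).2
        · rw [update_comm hkj.symm]
          refine ih _ (Finset.erase_ssubset hk) (Finset.mem_erase.2 ⟨hkj.symm, hj⟩) _ ?_ ?_
          · rw [update_comm hkj]
            exact 𝔄.update_mem_Cacc_erase hC₁ hk (by simpa [hkj] using he)
          · rw [update_comm hkj]
            exact 𝔄.update_mem_Cacc_erase hC₂ hk (by simpa [hkj] using he)
    refine ⟨hC, ?_⟩
    simpa [hF₁, hF₂] using (𝔄.F_add_F_update hj z hC₁ hC₂ hC).symm

end AdditiveSystem

/-- `W(x)` is contained in `V(x) × V(x)` and defines an equivalence relation on `V(x)`. -/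
theorem AdditiveSystem.W_equivalence {m : ℕ} {X : Fin (m + 1) → Type*}
    {A : Finset (Fin (m + 1)) → Type*} [∀ S, AddCommGroup (A S)] [∀ S, Module (ZMod 2) (A S)]
    (𝔄 : AdditiveSystem (m + 1) X A) (x : ∀ i, X i × X i)
    (V : Set (X (Fin.last m)))
    (hV : V = {a | Function.update x (Fin.last m) (a, a) ∈
      𝔄.Cacc (Finset.univ.erase (Fin.last m))})
    (W : Set (X (Fin.last m) × X (Fin.last m)))
    (hW : W = {p | Function.update x (Fin.last m) p ∈ 𝔄.Cacc Finset.univ}) :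
    (∀ p ∈ W, p.1 ∈ V ∧ p.2 ∈ V) ∧
    (∀ a ∈ V, (a, a) ∈ W) ∧
    (∀ a b, (a, b) ∈ W → (b, a) ∈ W) ∧
    (∀ a b c, (a, b) ∈ W → (b, c) ∈ W → (a, c) ∈ W) := by
  subst hV hW
  have hj := Finset.mem_univ (Fin.last m)
  exact ⟨fun p ⟨hp, _⟩ => 𝔄.faces_mem_Cacc hj hp,
    fun a ha => 𝔄.update_diag_mem_Cacc hj ha,
    fun a b h => 𝔄.update_swap_mem_Cacc _ a b _ hj x h,
    fun a b c h₁ h₂ => 𝔄.update_trans_mem_Cacc _ a b c _ hj x h₁ h₂⟩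
end

section
/- Let K be a number field that is Galois over Q, let p be a rational prime, and let 𝔭 and 𝔮 be prime ideals of O_K lying above p. If the class of 𝔭 in the narrow class group Cl⁺(K) lies in the subgroup 2·Cl⁺(K) of squares, then the class of 𝔮 also lies in 2·Cl⁺(K). -/
open NumberField
open scoped nonZeroDivisors

/-- The narrow class group of a number field: invertible fractional ideals modulo principal
fractional ideals generated by totally positive elements. -/
noncomputable def narrowClassGroup (K : Type*) [Field K] [NumberField K] : Type _ :=
  (FractionalIdeal (𝓞 K)⁰ K)ˣ ⧸
    Subgroup.closure
      {I : (FractionalIdeal (𝓞 K)⁰ K)ˣ |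
        ∃ x : Kˣ, (∀ φ : K →+* ℝ, 0 < φ (x : K)) ∧ toPrincipalIdeal (𝓞 K) K x = I}

noncomputable instance (K : Type*) [Field K] [NumberField K] : CommGroup (narrowClassGroup K) :=
  inferInstanceAs (CommGroup (_ ⧸ _))

/-- The class of a nonzero ideal in the narrow class group. -/
noncomputable def narrowClassOf (K : Type*) [Field K] [NumberField K] (P : (Ideal (𝓞 K))⁰) :
    narrowClassGroup K :=
  QuotientGroup.mk (FractionalIdeal.mk0 K P)

section Extension

variable {K : Type*} [Field K] [NumberField K] (f : 𝓞 K →+* 𝓞 K)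
  (hf : (𝓞 K)⁰ ≤ (𝓞 K)⁰.comap f)

/-- Extending ideals along an injective endomorphism of `𝓞 K` induces an endomorphism of the
narrow class group. -/
noncomputable def narrowClassGroupMap : narrowClassGroup K →* narrowClassGroup K :=
  QuotientGroup.map _ _ (Units.map (FractionalIdeal.extendedHom' K hf).toMonoidHom) <| by
    rw [Subgroup.closure_le]
    rintro _ ⟨x, hx, rfl⟩
    let τ : K →+* K := IsLocalization.map K f hf
    refine Subgroup.subset_closure ⟨Units.map τ.toMonoidHom x, fun φ ↦ hx (φ.comp τ), ?_⟩
    rw [toPrincipalIdeal_eq_iff]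
    simpa [τ] using (FractionalIdeal.extended_spanSingleton K hf (x : K)).symm

theorem narrowClassGroupMap_narrowClassOf {P Q : (Ideal (𝓞 K))⁰}
    (h : (P : Ideal (𝓞 K)).map f = Q) :
    narrowClassGroupMap f hf (narrowClassOf K P) = narrowClassOf K Q := by
  refine congrArg QuotientGroup.mk (Units.ext ?_)
  simp [FractionalIdeal.extended_coeIdeal_eq_map, h]

end Extension

/-- In a Galois number field, if one prime above `p` has narrow ideal class a square, then so
does any other prime above `p`. -/
theorem narrowClass_isSquare_of_isSquare (K : Type*) [Field K] [NumberField K]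
    [IsGalois ℚ K] (p : ℕ) (hp : p.Prime) (P Q : (Ideal (𝓞 K))⁰)
    (hP : (P : Ideal (𝓞 K)).IsPrime) (hQ : (Q : Ideal (𝓞 K)).IsPrime)
    (hPp : (p : 𝓞 K) ∈ (P : Ideal (𝓞 K))) (hQp : (p : 𝓞 K) ∈ (Q : Ideal (𝓞 K)))
    (hsq : ∃ y : narrowClassGroup K, narrowClassOf K P = y * y) :
    ∃ y : narrowClassGroup K, narrowClassOf K Q = y * y := by
  have hp' := Nat.prime_iff_prime_int.mp hp
  have := (Ideal.liesOver_span_iff hP.ne_top hp').mpr (by simpa using hPp)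
  have := (Ideal.liesOver_span_iff hQ.ne_top hp').mpr (by simpa using hQp)
  obtain ⟨σ, hσ⟩ := Ideal.exists_smul_eq_of_isGaloisGroup (Ideal.span {(p : ℤ)})
    (P : Ideal (𝓞 K)) Q (K ≃ₐ[ℚ] K)
  obtain ⟨y, hy⟩ := hsq
  let f := MulSemiringAction.toRingHom (K ≃ₐ[ℚ] K) (𝓞 K) σ
  have hf : (𝓞 K)⁰ ≤ (𝓞 K)⁰.comap f :=
    nonZeroDivisors_le_comap_nonZeroDivisors_of_injective f (MulAction.injective σ)
  refine ⟨narrowClassGroupMap f hf y, ?_⟩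
  rw [← narrowClassGroupMap_narrowClassOf f hf hσ, hy, map_mul]
end
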